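/- arXiv:1706.01578 — 2 statements merged into one kernel-verified Lean document; each statement's English description precedes it below -/
import Mathlib

section
/- Dual representation of the Brownian excursion (main theorem, interior time points): Let d ≥ 1, let 0 = s₀ < s₁ < … < s_d and 0 = t₀ < t₁ < … < t_d < 1 = t_{d+1}. Then ∫_{(0,∞)^d} exp(−∑_{k=1}^d (s_k − s_{k−1}) y_k) · f_{t₁,…,t_d}(y₁,…,y_d) dy₁…dy_d = (1/√(2π)) ∫_{(0,∞)^{d+1}} √(x₀) · exp(−(1/2) ∑_{k=0}^d (t_{k+1} − t_k) x_k) · ∏_{k=1}^d p_{s_k − s_{k−1}}(x_{k−1}, x_k) dx₀ dx₁ … dx_d. -/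
open MeasureTheory Real Finset

/-- Transition density `p_t(x,y)` of the auxiliary Markov process `X`. -/
noncomputable def transP (t x y : ℝ) : ℝ :=
  2 * t * Real.sqrt y / (Real.pi * ((y - x) ^ 2 + 2 * (x + y) * t ^ 2 + t ^ 4))

/-- The function `ℓ_t(y)`. -/
noncomputable def ellF (t y : ℝ) : ℝ :=
  if 0 < y then y * Real.exp (-(y ^ 2) / (2 * t)) / Real.sqrt (2 * Real.pi * t ^ 3) else 0

/-- The function `g_t(y₁,y₂)`. -/
noncomputable def gF (t y₁ y₂ : ℝ) : ℝ :=
  if 0 < y₁ ∧ 0 < y₂ then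
    (1 / Real.sqrt (2 * Real.pi * t)) *
      (Real.exp (-((y₁ - y₂) ^ 2) / (2 * t)) - Real.exp (-((y₁ + y₂) ^ 2) / (2 * t)))
  else 0

/-- The joint density `f_{t₁,…,t_{n+1}}(y₁,…,y_{n+1})` of the Brownian excursion
at `n+1` time points (indexed by `Fin (n+1)`). -/
noncomputable def excDensity (n : ℕ) (t y : Fin (n + 1) → ℝ) : ℝ :=
  Real.sqrt (8 * Real.pi) * ellF (t 0) (y 0) * ellF (1 - t (Fin.last n)) (y (Fin.last n)) *
    ∏ k : Fin n, gF (t k.succ - t k.castSucc) (y k.castSucc) (y k.succ)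

/-- Full-line cosine Gaussian integral. -/
lemma gauss_cos_full (t w : ℝ) (ht : 0 < t) :
    ∫ u : ℝ, Real.exp (-(t / 2) * u ^ 2) * Real.cos (w * u) =
      Real.sqrt (2 * π / t) * Real.exp (-(w ^ 2) / (2 * t)) := by
  have h := fourierIntegral_gaussian (b := ((t / 2 : ℝ) : ℂ)) (by simpa using ht) (w : ℂ)
  have h2 := congrArg Complex.re h
  rw [← RCLike.re_to_complex, ← integral_re] at h2
  · have e1 : ((π : ℂ) / ((t / 2 : ℝ) : ℂ)) ^ (1 / 2 : ℂ) = ((Real.sqrt (2 * π / t) : ℝ) : ℂ) := by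
      rw [Real.sqrt_eq_rpow, Complex.ofReal_cpow (by positivity)]
      congr 1
      · push_cast; field_simp
      · push_cast; rfl
    have e2 : Complex.exp (-(w : ℂ) ^ 2 / (4 * ((t / 2 : ℝ) : ℂ))) =
        ((Real.exp (-(w ^ 2) / (2 * t)) : ℝ) : ℂ) := by
      push_cast
      congr 1
      ring
    rw [e1, e2, ← Complex.ofReal_mul] at h2
    simp only [RCLike.re_to_complex, Complex.ofReal_re] at h2
    rw [← h2]
    congr 1
    ext u
    have e3 : Complex.exp (-((t / 2 : ℝ) : ℂ) * (u : ℂ) ^ 2) =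
        ((Real.exp (-(t / 2) * u ^ 2) : ℝ) : ℂ) := by
      push_cast; rfl
    rw [e3, Complex.re_mul_ofReal, Complex.exp_re]
    simp [mul_comm]
  · have hc : Integrable (fun u : ℝ => Real.exp (-(t / 2) * u ^ 2)) :=
      integrable_exp_neg_mul_sq (by positivity)
    refine hc.mono' (by fun_prop) (Filter.Eventually.of_forall fun u => ?_)
    rw [norm_mul, Complex.norm_exp, Complex.norm_exp]
    simp [← Complex.ofReal_pow]

lemma integrable_gauss_bdd (t : ℝ) (ht : 0 < t) (f : ℝ → ℝ) (hf : Continuous f)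
    (hb : ∀ u, |f u| ≤ 1) : Integrable (fun u : ℝ => Real.exp (-(t / 2) * u ^ 2) * f u) := by
  have hc : Integrable (fun u : ℝ => Real.exp (-(t / 2) * u ^ 2)) :=
    integrable_exp_neg_mul_sq (by positivity)
  refine hc.mono' (by fun_prop) (Filter.Eventually.of_forall fun u => ?_)
  rw [norm_mul, Real.norm_eq_abs, Real.norm_eq_abs, abs_of_pos (Real.exp_pos _)]
  exact mul_le_of_le_one_right (Real.exp_pos _).le (hb u)

lemma integrable_gauss_id_bdd (t : ℝ) (ht : 0 < t) (f : ℝ → ℝ) (hf : Continuous f)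
    (hb : ∀ u, |f u| ≤ 1) :
    Integrable (fun u : ℝ => Real.exp (-(t / 2) * u ^ 2) * (u * f u)) := by
  have hc : Integrable (fun u : ℝ => u * Real.exp (-(t / 2) * u ^ 2)) :=
    integrable_mul_exp_neg_mul_sq (by positivity)
  refine hc.norm.mono' (by fun_prop) (Filter.Eventually.of_forall fun u => ?_)
  rw [← mul_assoc, mul_comm (Real.exp _), norm_mul]
  exact mul_le_of_le_one_right (norm_nonneg _) (hb u)

lemma gauss_cos_half (t w : ℝ) (ht : 0 < t) :
    ∫ u in Set.Ioi (0 : ℝ), Real.exp (-(t / 2) * u ^ 2) * Real.cos (w * u) =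
      Real.sqrt (2 * π / t) * Real.exp (-(w ^ 2) / (2 * t)) / 2 := by
  have h := integral_comp_abs (f := fun u => Real.exp (-(t / 2) * u ^ 2) * Real.cos (w * u))
  rw [← gauss_cos_full t w ht, eq_div_iff two_ne_zero, mul_comm, ← h]
  congr 1
  ext u
  rcases abs_cases u with ⟨h, _⟩ | ⟨h, _⟩ <;> simp [h]

lemma sqrt_aux (t : ℝ) (ht : 0 < t) : Real.sqrt (2 * π / t) = 2 * π / Real.sqrt (2 * π * t) := by
  rw [eq_div_iff (by positivity), ← Real.sqrt_mul (by positivity)]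
  rw [show 2 * π / t * (2 * π * t) = (2 * π) ^ 2 by field_simp]
  exact Real.sqrt_sq (by positivity)

lemma gauss_sin_sin (t a b : ℝ) (ht : 0 < t) :
    ∫ u in Set.Ioi (0 : ℝ), Real.exp (-(t / 2) * u ^ 2) * (Real.sin (u * a) * Real.sin (u * b)) =
      π / 2 * ((1 / Real.sqrt (2 * π * t)) *
      (Real.exp (-((a - b) ^ 2) / (2 * t)) - Real.exp (-((a + b) ^ 2) / (2 * t)))) := by
  have e : ∀ u : ℝ, Real.exp (-(t / 2) * u ^ 2) * (Real.sin (u * a) * Real.sin (u * b)) =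
      (1 / 2) * (Real.exp (-(t / 2) * u ^ 2) * Real.cos ((a - b) * u) -
        Real.exp (-(t / 2) * u ^ 2) * Real.cos ((a + b) * u)) := by
    intro u
    rw [sub_mul, add_mul, Real.cos_sub, Real.cos_add, mul_comm a, mul_comm b]
    ring
  simp_rw [e]
  rw [integral_const_mul, integral_sub, gauss_cos_half t _ ht, gauss_cos_half t _ ht, sqrt_aux t ht]
  · ring
  · exact (integrable_gauss_bdd t ht _ (by fun_prop) fun u => Real.abs_cos_le_one _).integrableOn
  · exact (integrable_gauss_bdd t ht _ (by fun_prop) fun u => Real.abs_cos_le_one _).integrableOn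

lemma gauss_id_sin_full (t a : ℝ) (ht : 0 < t) :
    ∫ u : ℝ, Real.exp (-(t / 2) * u ^ 2) * (u * Real.sin (u * a)) =
      a / t * (Real.sqrt (2 * π / t) * Real.exp (-(a ^ 2) / (2 * t))) := by
  have hd : ∀ u : ℝ, HasDerivAt (fun u => Real.exp (-(t / 2) * u ^ 2) * Real.sin (u * a))
      (a * (Real.exp (-(t / 2) * u ^ 2) * Real.cos (a * u)) -
        t * (Real.exp (-(t / 2) * u ^ 2) * (u * Real.sin (u * a)))) u := by
    intro u
    have h1 := (((hasDerivAt_id u).pow 2).const_mul (-(t / 2))).exp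
    have h2 := ((hasDerivAt_id u).mul_const a).sin
    convert! h1.mul h2 using 1
    simp [mul_comm a u]
    ring
  have i1 := integrable_gauss_bdd t ht (fun u => Real.cos (a * u)) (by fun_prop)
    fun u => Real.abs_cos_le_one _
  have i2 := integrable_gauss_id_bdd t ht (fun u => Real.sin (u * a)) (by fun_prop)
    fun u => Real.abs_sin_le_one _
  have i3 := integrable_gauss_bdd t ht (fun u => Real.sin (u * a)) (by fun_prop)
    fun u => Real.abs_sin_le_one _
  have h := integral_eq_zero_of_hasDerivAt_of_integrable hd
    ((i1.const_mul a).sub (i2.const_mul t)) i3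
  rw [integral_sub (i1.const_mul a) (i2.const_mul t), integral_const_mul, integral_const_mul,
    gauss_cos_full t a ht] at h
  field_simp at h ⊢
  linarith

lemma gauss_id_sin (t a : ℝ) (ht : 0 < t) :
    ∫ u in Set.Ioi (0 : ℝ), Real.exp (-(t / 2) * u ^ 2) * (u * Real.sin (u * a)) =
      π * (a * Real.exp (-(a ^ 2) / (2 * t)) / Real.sqrt (2 * π * t ^ 3)) := by
  have h := integral_comp_abs (f := fun u => Real.exp (-(t / 2) * u ^ 2) * (u * Real.sin (u * a)))
  have h2 : ∫ u : ℝ, Real.exp (-(t / 2) * |u| ^ 2) * (|u| * Real.sin (|u| * a)) =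
      ∫ u : ℝ, Real.exp (-(t / 2) * u ^ 2) * (u * Real.sin (u * a)) := by
    congr 1
    ext u
    rcases abs_cases u with ⟨h, _⟩ | ⟨h, _⟩ <;> simp [h]
  rw [h2, gauss_id_sin_full t a ht, sqrt_aux t ht] at h
  have h3 : Real.sqrt (2 * π * t ^ 3) = t * Real.sqrt (2 * π * t) := by
    rw [show 2 * π * t ^ 3 = t ^ 2 * (2 * π * t) by ring, Real.sqrt_mul (by positivity),
      Real.sqrt_sq ht.le]
  rw [h3]
  have h4 : 0 < Real.sqrt (2 * π * t) := by positivity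
  field_simp at h ⊢
  linarith

lemma lap_cos (s w : ℝ) (hs : 0 < s) :
    IntegrableOn (fun y : ℝ => Real.exp (-(s * y)) * Real.cos (w * y)) (Set.Ioi 0) ∧
    ∫ y in Set.Ioi (0 : ℝ), Real.exp (-(s * y)) * Real.cos (w * y) = s / (s ^ 2 + w ^ 2) := by
  have hre : (-(s : ℂ) + w * Complex.I).re < 0 := by simpa using hs
  have hi := integrableOn_exp_mul_complex_Ioi hre 0
  have h := integral_exp_mul_complex_Ioi hre 0
  have e : ∀ y : ℝ, RCLike.re (Complex.exp ((-(s : ℂ) + w * Complex.I) * y)) =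
      Real.exp (-(s * y)) * Real.cos (w * y) := by
    intro y
    simp [Complex.exp_re]
  constructor
  · have := hi.re
    simpa only [e] using! this
  · have h2 := congrArg (RCLike.re : ℂ → ℝ) h
    rw [← integral_re hi] at h2
    simp only [e] at h2
    rw [h2]
    simp [Complex.div_re, Complex.normSq_apply]
    ring

lemma lap_sin_sin (s u v : ℝ) (hs : 0 < s) (hu : 0 < u) (hv : 0 < v) :
    ∫ y in Set.Ioi (0 : ℝ), Real.exp (-(s * y)) * (Real.sin (u * y) * Real.sin (v * y)) =
      π * u * (2 * s * Real.sqrt (v ^ 2) /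
        (π * ((v ^ 2 - u ^ 2) ^ 2 + 2 * (u ^ 2 + v ^ 2) * s ^ 2 + s ^ 4))) := by
  have e : ∀ y : ℝ, Real.exp (-(s * y)) * (Real.sin (u * y) * Real.sin (v * y)) =
      (1 / 2) * (Real.exp (-(s * y)) * Real.cos ((u - v) * y) -
        Real.exp (-(s * y)) * Real.cos ((u + v) * y)) := by
    intro y
    rw [sub_mul, add_mul, Real.cos_sub, Real.cos_add]
    ring
  simp_rw [e]
  rw [integral_const_mul, integral_sub (lap_cos s _ hs).1 (lap_cos s _ hs).1, (lap_cos s _ hs).2,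
    (lap_cos s _ hs).2, Real.sqrt_sq hv.le]
  have h1 : s ^ 2 + (u - v) ^ 2 ≠ 0 := by positivity
  have h2 : s ^ 2 + (u + v) ^ 2 ≠ 0 := by positivity
  have h3 : (v ^ 2 - u ^ 2) ^ 2 + 2 * (u ^ 2 + v ^ 2) * s ^ 2 + s ^ 4 =
    (s ^ 2 + (u - v) ^ 2) * (s ^ 2 + (u + v) ^ 2) := by ring
  rw [h3]
  field_simp
  ring

/-- change of variables `x = u ^ 2` in every coordinate -/
lemma cov_sq {m : ℕ} (G : (Fin m → ℝ) → ℝ) :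
    ∫ x in Set.univ.pi fun _ : Fin m => Set.Ioi (0 : ℝ), G x =
      ∫ u in Set.univ.pi fun _ : Fin m => Set.Ioi (0 : ℝ),
        (∏ j, (2 * u j)) * G (fun j => u j ^ 2) := by
  set S : Set (Fin m → ℝ) := Set.univ.pi fun _ : Fin m => Set.Ioi (0 : ℝ) with hS
  have himg : (fun (u : Fin m → ℝ) j => u j ^ 2) '' S = S := by
    ext x
    constructor
    · rintro ⟨u, hu, rfl⟩
      intro j _
      have := hu j trivial
      simp only [Set.mem_Ioi] at this ⊢
      positivity
    · intro hx
      refine ⟨fun j => Real.sqrt (x j), fun j _ => ?_, ?_⟩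
      · exact Real.sqrt_pos.2 (hx j trivial)
      · ext j
        exact Real.sq_sqrt (hx j trivial).le
  have hinj : Set.InjOn (fun (u : Fin m → ℝ) j => u j ^ 2) S := by
    intro u hu v hv h
    ext j
    have h1 := congrFun h j
    have hu' := hu j trivial
    have hv' := hv j trivial
    simp only [Set.mem_Ioi] at hu' hv' h1
    exact (pow_left_inj₀ hu'.le hv'.le two_ne_zero).1 h1
  have hSm : MeasurableSet S := MeasurableSet.univ_pi fun _ => measurableSet_Ioi
  have key := integral_image_eq_integral_abs_det_fderiv_smul volume hSm
    (f := fun (u : Fin m → ℝ) j => u j ^ 2)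
    (f' := fun u => ContinuousLinearMap.pi fun j =>
      (ContinuousLinearMap.toSpanSingleton ℝ (2 * u j)).comp (ContinuousLinearMap.proj j))
    (fun u _ => by
      rw [hasFDerivWithinAt_pi]
      intro j
      have h1 : HasDerivAt (fun z : ℝ => z ^ 2) (2 * u j) (u j) := by
        simpa using hasDerivAt_pow 2 (u j)
      have h2 := h1.hasFDerivAt.comp u
        ((ContinuousLinearMap.proj (R := ℝ) (φ := fun _ : Fin m => ℝ) j).hasFDerivAt)
      exact h2.hasFDerivWithinAt)
    hinj G
  rw [himg] at key
  rw [key]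
  refine setIntegral_congr_fun hSm fun u hu => ?_
  simp only [smul_eq_mul]
  congr 1
  rw [ContinuousLinearMap.det_pi]
  simp only [ContinuousLinearMap.det_toSpanSingleton]
  refine abs_of_nonneg (Finset.prod_nonneg fun j _ => ?_)
  have := hu j trivial
  simp only [Set.mem_Ioi] at this
  positivity

/-- The joint integrand in the spatial variables `y` and the frequency variables `u`. -/
noncomputable def jointH (n : ℕ) (σ : Fin (n + 1) → ℝ) (τ : Fin (n + 2) → ℝ)
    (y : Fin (n + 1) → ℝ) (u : Fin (n + 2) → ℝ) : ℝ :=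
  (∏ k, Real.exp (-(σ k * y k))) *
    ∏ j, (Real.exp (-(τ j / 2) * u j ^ 2) *
      (Fin.cons (α := fun _ => ℝ) (u j) (fun k => Real.sin (u j * y k)) j *
       Fin.snoc (α := fun _ => ℝ) (fun k => Real.sin (u j * y k)) (u j) j))

lemma restrict_orthant (m : ℕ) :
    (volume : Measure (Fin m → ℝ)).restrict (Set.univ.pi fun _ => Set.Ioi (0 : ℝ)) =
      Measure.pi fun _ => (volume : Measure ℝ).restrict (Set.Ioi (0 : ℝ)) := by
  rw [volume_pi, Measure.restrict_pi_pi]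

lemma jointH_int_u (n : ℕ) (σ : Fin (n + 1) → ℝ) (τ : Fin (n + 2) → ℝ) (hτ : ∀ j, 0 < τ j)
    (y : Fin (n + 1) → ℝ) (hy : ∀ k, 0 < y k) :
    ∫ u in Set.univ.pi fun _ => Set.Ioi (0 : ℝ), jointH n σ τ y u =
      (∏ k, Real.exp (-(σ k * y k))) * ((π * ellF (τ 0) (y 0)) *
        ((∏ i : Fin n, (π / 2 * gF (τ i.castSucc.succ) (y i.castSucc) (y i.succ))) *
          (π * ellF (τ (Fin.last (n + 1))) (y (Fin.last n))))) := by
  unfold jointH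
  rw [integral_const_mul, restrict_orthant, integral_fintype_prod_eq_prod (fun (j : Fin (n + 2))
    (v : ℝ) => (Real.exp (-(τ j / 2) * v ^ 2) *
      (Fin.cons (α := fun _ => ℝ) v (fun k => Real.sin (v * y k)) j *
       Fin.snoc (α := fun _ => ℝ) (fun k => Real.sin (v * y k)) v j)))]
  congr 1
  rw [Fin.prod_univ_succ (n := n + 1), Fin.prod_univ_castSucc (n := n)]
  congr 1
  · have h : ∀ v : ℝ, (Fin.snoc (α := fun _ => ℝ) (fun k => Real.sin (v * y k)) v 0 : ℝ) =
        Real.sin (v * y 0) := by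
      intro v
      exact Fin.snoc_castSucc (α := fun _ => ℝ) v (fun k => Real.sin (v * y k)) 0
    simp only [Fin.cons_zero, h]
    rw [gauss_id_sin _ _ (hτ 0), ellF, if_pos (hy 0)]
  congr 1
  · refine Finset.prod_congr rfl fun i _ => ?_
    have h : ∀ v : ℝ, (Fin.snoc (α := fun _ => ℝ) (fun k => Real.sin (v * y k)) v
        i.castSucc.succ : ℝ) = Real.sin (v * y i.succ) := by
      intro v
      rw [Fin.succ_castSucc]
      exact Fin.snoc_castSucc (α := fun _ => ℝ) v (fun k => Real.sin (v * y k)) i.succ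
    simp only [Fin.cons_succ, h]
    rw [gauss_sin_sin _ _ _ (hτ _), gF, if_pos ⟨hy _, hy _⟩]
  · have h : ∀ v : ℝ, (Fin.snoc (α := fun _ => ℝ) (fun k => Real.sin (v * y k)) v
        (Fin.last n).succ : ℝ) = v := by
      intro v
      rw [Fin.succ_last]
      exact Fin.snoc_last (α := fun _ => ℝ) v (fun k => Real.sin (v * y k))
    simp only [Fin.cons_succ, h]
    simp only [mul_comm (Real.sin _)]
    rw [gauss_id_sin _ _ (hτ _), ellF, if_pos (hy _), Fin.succ_last]

lemma jointH_eq (n : ℕ) (σ : Fin (n + 1) → ℝ) (τ : Fin (n + 2) → ℝ)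
    (y : Fin (n + 1) → ℝ) (u : Fin (n + 2) → ℝ) :
    jointH n σ τ y u = ((∏ j, Real.exp (-(τ j / 2) * u j ^ 2)) * (u 0 * u (Fin.last (n + 1)))) *
      ∏ k, (Real.exp (-(σ k * y k)) *
        (Real.sin (u k.castSucc * y k) * Real.sin (u k.succ * y k))) := by
  unfold jointH
  simp only [Finset.prod_mul_distrib]
  have h1 : ∏ j : Fin (n + 2), (Fin.cons (α := fun _ => ℝ) (u j) (fun k => Real.sin (u j * y k)) j : ℝ)
      = u 0 * ∏ k : Fin (n + 1), Real.sin (u k.succ * y k) := by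
    rw [Fin.prod_univ_succ]
    simp only [Fin.cons_zero, Fin.cons_succ]
  have h2 : ∏ j : Fin (n + 2), (Fin.snoc (α := fun _ => ℝ) (fun k => Real.sin (u j * y k)) (u j) j : ℝ)
      = (∏ k : Fin (n + 1), Real.sin (u k.castSucc * y k)) * u (Fin.last (n + 1)) := by
    rw [Fin.prod_univ_castSucc]
    simp only [Fin.snoc_castSucc, Fin.snoc_last]
  rw [h1, h2]
  ring

lemma jointH_int_y (n : ℕ) (σ : Fin (n + 1) → ℝ) (hσ : ∀ k, 0 < σ k) (τ : Fin (n + 2) → ℝ)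
    (u : Fin (n + 2) → ℝ) (hu : ∀ k, 0 < u k) :
    ∫ y in Set.univ.pi fun _ => Set.Ioi (0 : ℝ), jointH n σ τ y u =
      ((∏ j, Real.exp (-(τ j / 2) * u j ^ 2)) * (u 0 * u (Fin.last (n + 1)))) *
        ∏ k : Fin (n + 1), (π * u k.castSucc * transP (σ k) (u k.castSucc ^ 2) (u k.succ ^ 2)) := by
  simp only [jointH_eq]
  rw [integral_const_mul, restrict_orthant, integral_fintype_prod_eq_prod (fun (k : Fin (n + 1))
    (v : ℝ) => Real.exp (-(σ k * v)) *
        (Real.sin (u k.castSucc * v) * Real.sin (u k.succ * v)))]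
  congr 1
  refine Finset.prod_congr rfl fun k _ => ?_
  rw [lap_sin_sin _ _ _ (hσ k) (hu _) (hu _), transP]

lemma integrable_gauss_poly (t : ℝ) (ht : 0 < t) :
    Integrable (fun u : ℝ => Real.exp (-(t / 2) * u ^ 2) * (2 * (1 + u ^ 2))) := by
  have h0 : Integrable (fun u : ℝ => Real.exp (-(t / 2) * u ^ 2)) :=
    integrable_exp_neg_mul_sq (by positivity)
  have h2 : Integrable (fun u : ℝ => u ^ (2 : ℝ) * Real.exp (-(t / 2) * u ^ 2)) :=
    integrable_rpow_mul_exp_neg_mul_sq (by positivity) (by norm_num)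
  refine ((h0.const_mul 2).add (h2.const_mul 2)).congr (Filter.Eventually.of_forall fun u => ?_)
  simp only [Pi.add_apply, Real.rpow_two]
  ring

lemma jointH_integrable (n : ℕ) (σ : Fin (n + 1) → ℝ) (hσ : ∀ k, 0 < σ k) (τ : Fin (n + 2) → ℝ)
    (hτ : ∀ j, 0 < τ j) :
    Integrable (Function.uncurry (jointH n σ τ))
      (((volume : Measure (Fin (n + 1) → ℝ)).restrict (Set.univ.pi fun _ => Set.Ioi (0 : ℝ))).prod
       ((volume : Measure (Fin (n + 2) → ℝ)).restrict (Set.univ.pi fun _ => Set.Ioi (0 : ℝ)))) := by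
  have i1 : Integrable (fun y : Fin (n + 1) → ℝ => ∏ k, Real.exp (-(σ k * y k)))
      ((volume : Measure (Fin (n + 1) → ℝ)).restrict (Set.univ.pi fun _ => Set.Ioi (0 : ℝ))) := by
    rw [restrict_orthant]
    refine Integrable.fintype_prod (f := fun k v => Real.exp (-(σ k * v))) fun k => ?_
    simpa only [neg_mul] using! exp_neg_integrableOn_Ioi 0 (hσ k)
  have i2 : Integrable (fun u : Fin (n + 2) → ℝ =>
      ∏ j, (Real.exp (-(τ j / 2) * u j ^ 2) * (2 * (1 + u j ^ 2))))
      ((volume : Measure (Fin (n + 2) → ℝ)).restrict (Set.univ.pi fun _ => Set.Ioi (0 : ℝ))) := by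
    rw [restrict_orthant]
    exact Integrable.fintype_prod
      (f := fun j v => Real.exp (-(τ j / 2) * v ^ 2) * (2 * (1 + v ^ 2)))
      fun j => (integrable_gauss_poly _ (hτ j)).integrableOn
  refine (i1.mul_prod i2).mono' ?_ (Filter.Eventually.of_forall fun z => ?_)
  · have : Function.uncurry (jointH n σ τ) = fun z : (Fin (n + 1) → ℝ) × (Fin (n + 2) → ℝ) =>
        ((∏ j, Real.exp (-(τ j / 2) * z.2 j ^ 2)) * (z.2 0 * z.2 (Fin.last (n + 1)))) *
      ∏ k, (Real.exp (-(σ k * z.1 k)) *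
        (Real.sin (z.2 k.castSucc * z.1 k) * Real.sin (z.2 k.succ * z.1 k))) := by
      ext z
      exact jointH_eq n σ τ z.1 z.2
    rw [this]
    exact Continuous.aestronglyMeasurable (by fun_prop)
  · simp only [Function.uncurry, jointH]
    rw [norm_mul, Real.norm_eq_abs, abs_of_nonneg (Finset.prod_nonneg fun k _ => (Real.exp_pos _).le),
      Real.norm_eq_abs, Finset.abs_prod]
    refine mul_le_mul_of_nonneg_left ?_ (Finset.prod_nonneg fun k _ => (Real.exp_pos _).le)
    refine Finset.prod_le_prod (fun j _ => abs_nonneg _) fun j _ => ?_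
    rw [abs_mul, abs_of_pos (Real.exp_pos _), abs_mul]
    refine mul_le_mul_of_nonneg_left ?_ (Real.exp_pos _).le
    have hs : ∀ k, |Real.sin (z.2 j * z.1 k)| ≤ 1 + |z.2 j| := fun k =>
      (Real.abs_sin_le_one _).trans (by linarith [abs_nonneg (z.2 j)])
    have ha : |(Fin.cons (α := fun _ => ℝ) (z.2 j) (fun k => Real.sin (z.2 j * z.1 k)) j : ℝ)| ≤
        1 + |z.2 j| := by
      generalize z.2 j = v at hs ⊢
      refine Fin.cases ?_ (fun k => ?_) j
      · simp
      · simpa using hs k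
    have hb : |(Fin.snoc (α := fun _ => ℝ) (fun k => Real.sin (z.2 j * z.1 k)) (z.2 j) j : ℝ)| ≤
        1 + |z.2 j| := by
      generalize z.2 j = v at hs ⊢
      refine Fin.lastCases ?_ (fun k => ?_) j
      · rw [Fin.snoc_last]; linarith
      · rw [Fin.snoc_castSucc]; exact hs k
    calc _ ≤ (1 + |z.2 j|) * (1 + |z.2 j|) :=
          mul_le_mul ha hb (abs_nonneg _) (by positivity)
      _ ≤ _ := by nlinarith [sq_abs (z.2 j), sq_nonneg (1 - |z.2 j|)]

/-- **Dual representation of the Brownian excursion (interior time points).**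
Here `d = n + 1 ≥ 1`, `s : Fin (n+2) → ℝ` lists `s₀ < s₁ < … < s_d` with `s₀ = 0`, and
`t : Fin (n+3) → ℝ` lists `t₀ < t₁ < … < t_d < t_{d+1}` with `t₀ = 0` and `t_{d+1} = 1`. -/
theorem excursion_dual_interior (n : ℕ) (s : Fin (n + 2) → ℝ) (t : Fin (n + 3) → ℝ)
    (hs0 : s 0 = 0) (hs : StrictMono s)
    (ht0 : t 0 = 0) (htlast : t (Fin.last (n + 2)) = 1) (ht : StrictMono t) :
    (∫ y : Fin (n + 1) → ℝ in Set.univ.pi fun _ => Set.Ioi (0 : ℝ),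
        Real.exp (-(∑ k : Fin (n + 1), (s k.succ - s k.castSucc) * y k)) *
          excDensity n (fun i => t i.succ.castSucc) y) =
      (1 / Real.sqrt (2 * Real.pi)) *
        ∫ x : Fin (n + 2) → ℝ in Set.univ.pi fun _ => Set.Ioi (0 : ℝ),
          Real.sqrt (x 0) *
            Real.exp (-(1 / 2 : ℝ) * ∑ k : Fin (n + 2), (t k.succ - t k.castSucc) * x k) *
            ∏ k : Fin (n + 1), transP (s k.succ - s k.castSucc) (x k.castSucc) (x k.succ) := by
  set σ : Fin (n + 1) → ℝ := fun k => s k.succ - s k.castSucc with hσd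
  set τ : Fin (n + 2) → ℝ := fun k => t k.succ - t k.castSucc with hτd
  have hσ : ∀ k, 0 < σ k := fun k => sub_pos.2 (hs Fin.castSucc_lt_succ)
  have hτ : ∀ k, 0 < τ k := fun k => sub_pos.2 (ht Fin.castSucc_lt_succ)
  have hSm : ∀ m : ℕ, MeasurableSet (Set.univ.pi fun _ : Fin m => Set.Ioi (0 : ℝ)) :=
    fun m => MeasurableSet.univ_pi fun _ => measurableSet_Ioi
  have hpi : (π : ℝ) ≠ 0 := Real.pi_ne_zero
  have hL : ∀ y ∈ (Set.univ.pi fun _ : Fin (n + 1) => Set.Ioi (0 : ℝ)),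
      Real.exp (-(∑ k : Fin (n + 1), (s k.succ - s k.castSucc) * y k)) *
          excDensity n (fun i => t i.succ.castSucc) y =
      Real.sqrt (8 * π) / (π ^ 2 * (π / 2) ^ n) *
        ∫ u in Set.univ.pi fun _ => Set.Ioi (0 : ℝ), jointH n σ τ y u := by
    intro y hy
    rw [jointH_int_u n σ τ hτ y fun k => hy k trivial, ← Real.exp_sum, Finset.sum_neg_distrib,
      Finset.prod_mul_distrib, Finset.prod_const, Finset.card_univ, Fintype.card_fin]
    have e0 : t (Fin.succ 0).castSucc = τ 0 := by
      simp only [hτd, Fin.castSucc_zero, ht0, sub_zero]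
      rfl
    have e1 : 1 - t (Fin.last n).succ.castSucc = τ (Fin.last (n + 1)) := by
      simp only [hτd, Fin.succ_last, htlast]
    have e2 : ∀ k : Fin n, t k.succ.succ.castSucc - t k.castSucc.succ.castSucc =
        τ k.castSucc.succ := by
      intro k
      simp only [hτd]
      rfl
    simp only [excDensity, e0, e1, e2]
    field_simp
    simp only [hσd]
    ring
  have hR : ∀ u ∈ (Set.univ.pi fun _ : Fin (n + 2) => Set.Ioi (0 : ℝ)),
      (∏ j, (2 * u j)) * (Real.sqrt (u 0 ^ 2) *
            Real.exp (-(1 / 2 : ℝ) * ∑ k : Fin (n + 2), (t k.succ - t k.castSucc) * u k ^ 2) *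
            ∏ k : Fin (n + 1), transP (s k.succ - s k.castSucc) (u k.castSucc ^ 2) (u k.succ ^ 2)) =
      2 ^ (n + 2) / π ^ (n + 1) *
        ∫ y in Set.univ.pi fun _ => Set.Ioi (0 : ℝ), jointH n σ τ y u := by
    intro u hu
    rw [jointH_int_y n σ hσ τ u fun k => hu k trivial, ← Real.exp_sum,
      Real.sqrt_sq (le_of_lt (hu 0 trivial))]
    simp only [Finset.prod_mul_distrib, Finset.prod_const, Finset.card_univ, Fintype.card_fin]
    rw [Fin.prod_univ_castSucc (fun j => u j)]
    have e : ∑ j, -(τ j / 2) * u j ^ 2 =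
        -(1 / 2 : ℝ) * ∑ k : Fin (n + 2), (t k.succ - t k.castSucc) * u k ^ 2 := by
      rw [Finset.mul_sum]
      refine Finset.sum_congr rfl fun j _ => ?_
      simp only [hτd]
      ring
    rw [e]
    field_simp
    simp only [hσd]
  rw [cov_sq (m := n + 2), setIntegral_congr_fun (hSm _) hL, setIntegral_congr_fun (hSm _) hR,
    integral_const_mul, integral_const_mul,
    integral_integral_swap (jointH_integrable n σ hσ τ hτ), ← mul_assoc]
  congr 1
  have h8 : Real.sqrt (8 * π) = 2 * Real.sqrt (2 * π) := by
    rw [show 8 * π = 2 ^ 2 * (2 * π) by ring, Real.sqrt_mul (by positivity),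
      Real.sqrt_sq (by norm_num)]
  have hq : Real.sqrt (2 * π) ^ 2 = 2 * π := Real.sq_sqrt (by positivity)
  have hq0 : Real.sqrt (2 * π) ≠ 0 := by positivity
  rw [h8, div_pow]
  field_simp
  rw [hq]
  ring
end

section
/- Dual representation of the Brownian excursion, boundary case t_d = 1: Let d ≥ 2, let 0 = s₀ < s₁ < … < s_d and 0 < t₁ < … < t_{d−1} < t_d = 1 = t_{d+1}. Then (1/√(2π)) ∫_{(0,∞)^{d+1}} √(x₀) · exp(−(1/2) ∑_{k=0}^d (t_{k+1} − t_k) x_k) · ∏_{k=1}^d p_{s_k − s_{k−1}}(x_{k−1}, x_k) dx₀ dx₁ … dx_d = ∫_{(0,∞)^{d−1}} exp(−∑_{k=1}^{d−1} (s_k − s_{k−1}) y_k) · f_{t₁,…,t_{d−1}}(y₁,…,y_{d−1}) dy₁…dy_{d−1}, where t₀ = 0 (note that the coefficient t_{d+1} − t_d of x_d is 0). -/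
open MeasureTheory Real Finset

lemma int_exp_cos {t : ℝ} (ht : 0 < t) (a : ℝ) :
    ∫ y in Set.Ioi (0:ℝ), Real.exp (-t * y) * Real.cos (a * y) = t / (a ^ 2 + t ^ 2) := by
  have hre : ((-t : ℂ) + a * Complex.I).re < 0 := by simpa using ht
  have h1 := integral_exp_mul_complex_Ioi hre 0
  have h2 := integral_re (integrableOn_exp_mul_complex_Ioi hre 0)
  rw [h1] at h2
  have e : ∀ y : ℝ, RCLike.re (Complex.exp (((-t : ℂ) + a * Complex.I) * y))
      = Real.exp (-t * y) * Real.cos (a * y) := by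
    intro y
    rw [RCLike.re_eq_complex_re, Complex.exp_re]
    simp
  simp only [e] at h2
  rw [h2, RCLike.re_eq_complex_re]
  simp [Complex.div_re, Complex.normSq_apply]
  ring

lemma integrable_exp_sin_sin {t : ℝ} (ht : 0 < t) (u v : ℝ) :
    IntegrableOn (fun y => Real.exp (-t * y) * (Real.sin (u * y) * Real.sin (v * y)))
      (Set.Ioi (0:ℝ)) := by
  refine Integrable.mono' (exp_neg_integrableOn_Ioi 0 ht) (by fun_prop) ?_
  refine Filter.Eventually.of_forall fun y => ?_
  rw [norm_mul, norm_mul, Real.norm_of_nonneg (Real.exp_pos _).le]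
  have h1 := Real.abs_sin_le_one (u * y)
  have h2 := Real.abs_sin_le_one (v * y)
  have : ‖Real.sin (u * y)‖ * ‖Real.sin (v * y)‖ ≤ 1 := by
    simp only [Real.norm_eq_abs]
    exact mul_le_one₀ h1 (abs_nonneg _) h2
  calc _ ≤ Real.exp (-t * y) * 1 := by gcongr
    _ = _ := mul_one _

lemma integrable_exp_cos {t : ℝ} (ht : 0 < t) (a : ℝ) :
    IntegrableOn (fun y => Real.exp (-t * y) * Real.cos (a * y)) (Set.Ioi (0:ℝ)) := by
  refine Integrable.mono' (exp_neg_integrableOn_Ioi 0 ht) (by fun_prop) ?_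
  refine Filter.Eventually.of_forall fun y => ?_
  rw [norm_mul, Real.norm_of_nonneg (Real.exp_pos _).le]
  have h1 := Real.abs_cos_le_one (a * y)
  calc _ ≤ Real.exp (-t * y) * 1 := by gcongr; exact h1
    _ = _ := mul_one _

lemma int_exp_sin_sin {t : ℝ} (ht : 0 < t) (u v : ℝ) :
    ∫ y in Set.Ioi (0:ℝ), Real.exp (-t * y) * (Real.sin (u * y) * Real.sin (v * y))
      = (t / ((v - u) ^ 2 + t ^ 2) - t / ((v + u) ^ 2 + t ^ 2)) / 2 := by
  rw [← int_exp_cos ht, ← int_exp_cos ht,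
    ← integral_sub (integrable_exp_cos ht _) (integrable_exp_cos ht _), ← integral_div]
  congr 1; ext y
  rw [sub_mul, add_mul, Real.cos_sub, Real.cos_add]; ring

lemma transP_eq {t x y : ℝ} (ht : 0 < t) (hx : 0 < x) (hy : 0 < y) :
    transP t x y = ∫ z in Set.Ioi (0:ℝ), (1 / (Real.pi * √x)) *
      (Real.exp (-t * z) * (Real.sin (√x * z) * Real.sin (√y * z))) := by
  rw [integral_const_mul, int_exp_sin_sin ht, transP]
  obtain ⟨u, hu, rfl⟩ : ∃ u, 0 < u ∧ x = u ^ 2 := ⟨√x, by positivity, by rw [Real.sq_sqrt hx.le]⟩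
  obtain ⟨v, hv, rfl⟩ : ∃ v, 0 < v ∧ y = v ^ 2 := ⟨√y, by positivity, by rw [Real.sq_sqrt hy.le]⟩
  rw [Real.sqrt_sq hu.le, Real.sqrt_sq hv.le]
  have hA : (v - u) ^ 2 + t ^ 2 ≠ 0 := by positivity
  have hB : (v + u) ^ 2 + t ^ 2 ≠ 0 := by positivity
  have : (v ^ 2 - u ^ 2) ^ 2 + 2 * (u ^ 2 + v ^ 2) * t ^ 2 + t ^ 4
    = ((v - u) ^ 2 + t ^ 2) * ((v + u) ^ 2 + t ^ 2) := by ring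
  rw [this]
  field_simp
  ring

lemma transP_nonneg {t x y : ℝ} (ht : 0 < t) (hx : 0 < x) (hy : 0 < y) : 0 ≤ transP t x y := by
  unfold transP; positivity

lemma gauss_cos {b : ℝ} (hb : 0 < b) (a : ℝ) :
    ∫ u in Set.Ioi (0:ℝ), Real.exp (-b * u ^ 2) * Real.cos (a * u)
      = √(Real.pi / b) * Real.exp (-a ^ 2 / (4 * b)) / 2 := by
  have hbc : 0 < (b : ℂ).re := by simpa using hb
  have h1 := fourierIntegral_gaussian hbc a
  have hint : Integrable (fun x : ℝ =>
      Complex.exp (Complex.I * a * x) * Complex.exp (-(b:ℂ) * (x:ℂ) ^ 2)) := by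
    refine Integrable.mono' (integrable_exp_neg_mul_sq hb) (by fun_prop) ?_
    refine Filter.Eventually.of_forall fun y => ?_
    rw [norm_mul, Complex.norm_exp, Complex.norm_exp]
    simp [← Complex.ofReal_pow]
  have h2 := integral_re hint
  rw [h1] at h2
  have e : ∀ x : ℝ, RCLike.re (Complex.exp (Complex.I * a * x) * Complex.exp (-(b:ℂ) * (x:ℂ) ^ 2))
      = Real.exp (-b * |x| ^ 2) * Real.cos (a * |x|) := by
    intro x
    have : Complex.exp (-(b:ℂ) * (x:ℂ) ^ 2) = (Real.exp (-b * x ^ 2) : ℂ) := by push_cast; rfl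
    rw [RCLike.re_eq_complex_re, this, Complex.re_mul_ofReal, Complex.exp_re]
    have h3 : Real.cos (a * |x|) = Real.cos (a * x) := by
      rcases abs_choice x with h | h <;> rw [h]
      rw [mul_neg, Real.cos_neg]
    rw [h3, sq_abs]
    simp [mul_comm]
  simp only [e] at h2
  rw [integral_comp_abs (f := fun x => Real.exp (-b * x ^ 2) * Real.cos (a * x))] at h2
  have e2 : RCLike.re (((Real.pi : ℂ) / b) ^ (1 / 2 : ℂ) * Complex.exp (-(a:ℂ) ^ 2 / (4 * b)))
      = √(Real.pi / b) * Real.exp (-a ^ 2 / (4 * b)) := by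
    have h3 : Complex.exp (-(a:ℂ) ^ 2 / (4 * b)) = (Real.exp (-a ^ 2 / (4 * b)) : ℂ) := by
      push_cast; rfl
    have h4 : ((Real.pi : ℂ) / b) ^ (1 / 2 : ℂ) = (√(Real.pi / b) : ℂ) := by
      rw [Real.sqrt_eq_rpow, Complex.ofReal_cpow (by positivity)]
      push_cast; rfl
    rw [h3, h4, ← Complex.ofReal_mul, RCLike.re_eq_complex_re, Complex.ofReal_re]
  rw [e2] at h2
  linarith

lemma gauss_int_cos {b : ℝ} (hb : 0 < b) (a : ℝ) :
    IntegrableOn (fun u => Real.exp (-b * u ^ 2) * Real.cos (a * u)) (Set.Ioi (0:ℝ)) := by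
  refine Integrable.mono' (integrable_exp_neg_mul_sq hb).integrableOn (by fun_prop) ?_
  refine Filter.Eventually.of_forall fun y => ?_
  rw [norm_mul, Real.norm_of_nonneg (Real.exp_pos _).le]
  have h1 := Real.abs_cos_le_one (a * y)
  calc _ ≤ Real.exp (-b * y ^ 2) * 1 := by gcongr; exact h1
    _ = _ := mul_one _

lemma gauss_int_usin {b : ℝ} (hb : 0 < b) (a : ℝ) :
    IntegrableOn (fun u => u * (Real.exp (-b * u ^ 2) * Real.sin (a * u))) (Set.Ioi (0:ℝ)) := by
  refine Integrable.mono' (integrable_mul_exp_neg_mul_sq hb).norm.integrableOn (by fun_prop) ?_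
  refine Filter.Eventually.of_forall fun y => ?_
  rw [norm_mul, norm_mul, norm_mul]
  have h1 := Real.abs_sin_le_one (a * y)
  calc _ ≤ ‖y‖ * (‖Real.exp (-b * y ^ 2)‖ * 1) := by gcongr; exact h1
    _ = _ := by rw [mul_one]

lemma gauss_usin {b : ℝ} (hb : 0 < b) (a : ℝ) :
    ∫ u in Set.Ioi (0:ℝ), u * (Real.exp (-b * u ^ 2) * Real.sin (a * u))
      = a / (2 * b) * (√(Real.pi / b) * Real.exp (-a ^ 2 / (4 * b)) / 2) := by
  have key := integral_Ioi_of_hasDerivAt_of_tendsto (a := 0) (m := 0)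
    (f := fun u => -(1 / (2 * b)) * (Real.exp (-b * u ^ 2) * Real.sin (a * u)))
    (f' := fun u => u * (Real.exp (-b * u ^ 2) * Real.sin (a * u))
      - a / (2 * b) * (Real.exp (-b * u ^ 2) * Real.cos (a * u)))
    (by fun_prop) ?_ ((gauss_int_usin hb a).sub ((gauss_int_cos hb a).const_mul _)) ?_
  · rw [integral_sub (gauss_int_usin hb a) ((gauss_int_cos hb a).const_mul _),
      integral_const_mul, gauss_cos hb] at key
    simp only [mul_zero, Real.sin_zero, sub_zero] at key
    linarith
  · intro u _
    have h1 : HasDerivAt (fun u : ℝ => Real.exp (-b * u ^ 2))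
        (Real.exp (-b * u ^ 2) * (-b * (2 * u))) u := by
      simpa using ((hasDerivAt_pow 2 u).const_mul (-b)).exp
    have h2 : HasDerivAt (fun u : ℝ => Real.sin (a * u)) (Real.cos (a * u) * a) u := by
      simpa using ((hasDerivAt_id u).const_mul a).sin
    refine ((h1.mul h2).const_mul (-(1 / (2 * b)))).congr_deriv ?_
    field_simp
    ring
  · rw [show (0:ℝ) = -(1 / (2 * b)) * 0 by simp]
    refine Filter.Tendsto.const_mul _ ?_
    refine squeeze_zero_norm (a := fun u => Real.exp (-b * u ^ 2)) (fun u => ?_) ?_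
    · rw [norm_mul, Real.norm_of_nonneg (Real.exp_pos _).le]
      have h1 := Real.abs_sin_le_one (a * u)
      calc _ ≤ Real.exp (-b * u ^ 2) * 1 := by gcongr; exact h1
        _ = _ := mul_one _
    · refine Real.tendsto_exp_atBot.comp ?_
      exact Filter.Tendsto.const_mul_atTop_of_neg (by linarith)
        (Filter.tendsto_pow_atTop (by norm_num))

lemma subst_sq (g : ℝ → ℝ) :
    ∫ x in Set.Ioi (0:ℝ), g x = ∫ u in Set.Ioi (0:ℝ), 2 * u * g (u ^ 2) := by
  rw [← integral_comp_rpow_Ioi_of_pos (g := g) (p := 2) (by norm_num)]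
  refine setIntegral_congr_fun measurableSet_Ioi fun u _ => ?_
  norm_num

lemma end_int {τ y : ℝ} (hτ : 0 < τ) (hy : 0 < y) :
    ∫ x in Set.Ioi (0:ℝ), Real.exp (-(τ / 2) * x) * Real.sin (√x * y)
      = 2 * Real.pi * ellF τ y := by
  rw [subst_sq]
  have : ∀ u ∈ Set.Ioi (0:ℝ), 2 * u * (Real.exp (-(τ / 2) * u ^ 2) * Real.sin (√(u ^ 2) * y))
      = 2 * (u * (Real.exp (-(τ / 2) * u ^ 2) * Real.sin (y * u))) := by
    intro u hu
    rw [Real.sqrt_sq (le_of_lt hu), mul_comm u y]; ring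
  rw [setIntegral_congr_fun measurableSet_Ioi this, integral_const_mul,
    gauss_usin (by positivity), ellF, if_pos hy]
  have h1 : √(2 * Real.pi * τ ^ 3) = τ * √(2 * Real.pi * τ) := by
    rw [show 2 * Real.pi * τ ^ 3 = τ ^ 2 * (2 * Real.pi * τ) by ring,
      Real.sqrt_mul (by positivity), Real.sqrt_sq hτ.le]
  have h2 : √(Real.pi / (τ / 2)) = 2 * Real.pi / √(2 * Real.pi * τ) := by
    rw [eq_div_iff (by positivity), ← Real.sqrt_mul (by positivity),
      show Real.pi / (τ / 2) * (2 * Real.pi * τ) = (2 * Real.pi) ^ 2 by field_simp,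
      Real.sqrt_sq (by positivity)]
  have h3 : -y ^ 2 / (4 * (τ / 2)) = -(y ^ 2) / (2 * τ) := by ring
  rw [h1, h2, h3]
  field_simp

lemma mid_int {τ y z : ℝ} (hτ : 0 < τ) (hy : 0 < y) (hz : 0 < z) :
    ∫ x in Set.Ioi (0:ℝ), Real.exp (-(τ / 2) * x) * Real.sin (√x * y) * Real.sin (√x * z) / √x
      = Real.pi * gF τ y z := by
  rw [subst_sq]
  have hb : 0 < τ / 2 := by positivity
  have : ∀ u ∈ Set.Ioi (0:ℝ), 2 * u * (Real.exp (-(τ / 2) * u ^ 2) * Real.sin (√(u ^ 2) * y)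
        * Real.sin (√(u ^ 2) * z) / √(u ^ 2))
      = Real.exp (-(τ / 2) * u ^ 2) * Real.cos ((y - z) * u)
        - Real.exp (-(τ / 2) * u ^ 2) * Real.cos ((y + z) * u) := by
    intro u hu
    have hu' : 0 < u := hu
    rw [Real.sqrt_sq hu'.le, mul_comm u y, mul_comm u z, sub_mul, add_mul, Real.cos_sub,
      Real.cos_add]
    field_simp
    ring
  rw [setIntegral_congr_fun measurableSet_Ioi this,
    integral_sub (gauss_int_cos hb _) (gauss_int_cos hb _),
    gauss_cos hb, gauss_cos hb, gF, if_pos ⟨hy, hz⟩]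
  have h2 : √(Real.pi / (τ / 2)) = 2 * Real.pi / √(2 * Real.pi * τ) := by
    rw [eq_div_iff (by positivity), ← Real.sqrt_mul (by positivity),
      show Real.pi / (τ / 2) * (2 * Real.pi * τ) = (2 * Real.pi) ^ 2 by field_simp,
      Real.sqrt_sq (by positivity)]
  have h3 : -(y - z) ^ 2 / (4 * (τ / 2)) = -((y - z) ^ 2) / (2 * τ) := by ring
  have h4 : -(y + z) ^ 2 / (4 * (τ / 2)) = -((y + z) ^ 2) / (2 * τ) := by ring
  rw [h2, h3, h4]
  field_simp

/-- Antiderivative of the transition density, in the variable `v = √y`. -/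
noncomputable def primK (t u v : ℝ) : ℝ :=
  t / (Real.pi * u) * ((Real.log ((v - u) ^ 2 + t ^ 2) - Real.log ((v + u) ^ 2 + t ^ 2)) / 2
    + u / t * (Real.arctan ((v - u) / t) + Real.arctan ((v + u) / t)))

lemma primK_deriv {t u : ℝ} (ht : 0 < t) (hu : 0 < u) (v : ℝ) :
    HasDerivAt (primK t u)
      (4 * t * v ^ 2 / (Real.pi * (((v - u) ^ 2 + t ^ 2) * ((v + u) ^ 2 + t ^ 2)))) v := by
  have hA : (v - u) ^ 2 + t ^ 2 ≠ 0 := by positivity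
  have hB : (v + u) ^ 2 + t ^ 2 ≠ 0 := by positivity
  have a1 : HasDerivAt (fun v : ℝ => (v - u)) 1 v := (hasDerivAt_id v).sub_const u
  have a2 : HasDerivAt (fun v : ℝ => (v + u)) 1 v := (hasDerivAt_id v).add_const u
  have b1 := ((a1.pow 2).add_const (t ^ 2)).log hA
  have b2 := ((a2.pow 2).add_const (t ^ 2)).log hB
  have c1 := (a1.div_const t).arctan
  have c2 := (a2.div_const t).arctan
  have := (((b1.sub b2).div_const 2).add ((c1.add c2).const_mul (u / t))).const_mul
    (t / (Real.pi * u))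
  refine HasDerivAt.congr_deriv (f := primK t u) this ?_
  have d1 : (1 + ((v - u) / t) ^ 2) = ((v - u) ^ 2 + t ^ 2) / t ^ 2 := by field_simp; ring
  have d2 : (1 + ((v + u) / t) ^ 2) = ((v + u) ^ 2 + t ^ 2) / t ^ 2 := by field_simp; ring
  rw [d1, d2]
  simp only [Pi.pow_apply]
  field_simp
  ring

lemma primK_zero (t u : ℝ) : primK t u 0 = 0 := by
  have : (0 - u) / t = - ((0 + u) / t) := by ring
  unfold primK
  rw [this, Real.arctan_neg]; simp

lemma primK_tendsto {t u : ℝ} (ht : 0 < t) (hu : 0 < u) :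
    Filter.Tendsto (primK t u) Filter.atTop (nhds 1) := by
  have h1 : Filter.Tendsto (fun v : ℝ => Real.arctan ((v - u) / t)) Filter.atTop
      (nhds (Real.pi / 2)) :=
    (tendsto_nhds_of_tendsto_nhdsWithin Real.tendsto_arctan_atTop).comp
      ((Filter.tendsto_atTop_add_const_right _ (-u) Filter.tendsto_id).atTop_div_const ht)
  have h2 : Filter.Tendsto (fun v : ℝ => Real.arctan ((v + u) / t)) Filter.atTop
      (nhds (Real.pi / 2)) :=
    (tendsto_nhds_of_tendsto_nhdsWithin Real.tendsto_arctan_atTop).comp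
      ((Filter.tendsto_atTop_add_const_right _ u Filter.tendsto_id).atTop_div_const ht)
  have h3 : Filter.Tendsto (fun v : ℝ => Real.log ((v - u) ^ 2 + t ^ 2)
      - Real.log ((v + u) ^ 2 + t ^ 2)) Filter.atTop (nhds 0) := by
    have hinv : Filter.Tendsto (fun v : ℝ => v⁻¹) Filter.atTop (nhds 0) :=
      tendsto_inv_atTop_zero
    have hc : ContinuousAt (fun w : ℝ => Real.log ((1 - u * w) ^ 2 + (t * w) ^ 2)
        - Real.log ((1 + u * w) ^ 2 + (t * w) ^ 2)) 0 := by
      refine ContinuousAt.sub (ContinuousAt.log (by fun_prop) (by simp))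
        (ContinuousAt.log (by fun_prop) (by simp))
    have := hc.tendsto.comp hinv
    simp only [mul_zero, sub_zero, add_zero, sub_self] at this
    refine this.congr' ?_
    filter_upwards [Filter.eventually_gt_atTop 0] with v hv
    have e1 : (v - u) ^ 2 + t ^ 2 = v ^ 2 * ((1 - u * v⁻¹) ^ 2 + (t * v⁻¹) ^ 2) := by
      field_simp
    have e2 : (v + u) ^ 2 + t ^ 2 = v ^ 2 * ((1 + u * v⁻¹) ^ 2 + (t * v⁻¹) ^ 2) := by
      field_simp
    simp only [Function.comp]
    rw [e1, e2, Real.log_mul (by positivity) (by positivity),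
      Real.log_mul (by positivity) (by positivity)]
    ring
  have := ((h3.div_const 2).add ((h1.add h2).const_mul (u / t))).const_mul (t / (Real.pi * u))
  have e : t / (Real.pi * u) * (0 / 2 + u / t * (Real.pi / 2 + Real.pi / 2)) = 1 := by
    field_simp; ring
  rw [e] at this
  exact this

lemma transP_int_aux {t x : ℝ} (ht : 0 < t) (hx : 0 < x) :
    IntegrableOn (transP t x) (Set.Ioi 0) ∧ ∫ y in Set.Ioi (0:ℝ), transP t x y = 1 := by
  have hu : 0 < √x := by positivity
  have hc : ContinuousWithinAt (fun y => primK t (√x) (√y)) (Set.Ici 0) 0 := by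
    have : ContinuousAt (primK t (√x)) (√0) := (primK_deriv ht hu _).continuousAt
    exact (ContinuousAt.comp (f := Real.sqrt) this
      Real.continuous_sqrt.continuousAt).continuousWithinAt
  have hd : ∀ y ∈ Set.Ioi (0:ℝ), HasDerivAt (fun y => primK t (√x) (√y)) (transP t x y) y := by
    intro y hy
    have hy' : 0 < y := hy
    refine ((primK_deriv ht hu (√y)).comp y (Real.hasDerivAt_sqrt hy'.ne')).congr_deriv ?_
    have hA : (√y - √x) ^ 2 + t ^ 2 ≠ 0 := by positivity
    have hB : (√y + √x) ^ 2 + t ^ 2 ≠ 0 := by positivity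
    have : (y - x) ^ 2 + 2 * (x + y) * t ^ 2 + t ^ 4
      = ((√y - √x) ^ 2 + t ^ 2) * ((√y + √x) ^ 2 + t ^ 2) := by
      nth_rw 1 [← Real.sq_sqrt hx.le, ← Real.sq_sqrt hy'.le]
      nth_rw 2 [← Real.sq_sqrt hx.le, ← Real.sq_sqrt hy'.le]
      ring
    rw [transP, this]
    have hv : 0 < √y := by positivity
    field_simp
    ring
  have hn : ∀ y ∈ Set.Ioi (0:ℝ), 0 ≤ transP t x y := fun y hy => transP_nonneg ht hx hy
  have hl : Filter.Tendsto (fun y => primK t (√x) (√y)) Filter.atTop (nhds 1) :=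
    (primK_tendsto ht hu).comp Real.tendsto_sqrt_atTop
  refine ⟨integrableOn_Ioi_deriv_of_nonneg hc hd hn hl, ?_⟩
  rw [integral_Ioi_of_hasDerivAt_of_nonneg hc hd hn hl, Real.sqrt_zero, primK_zero, sub_zero]

/-- Lebesgue measure on the positive half line. -/
noncomputable def muP : Measure ℝ := volume.restrict (Set.Ioi 0)

instance : SigmaFinite muP := by unfold muP; infer_instance

lemma ae_pos_pi (m : ℕ) : ∀ᵐ x ∂(Measure.pi fun _ : Fin m => muP), ∀ k, 0 < x k := by
  have := ae_restrict_mem (μ := (volume : Measure (Fin m → ℝ)))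
    (MeasurableSet.univ_pi (fun _ : Fin m => measurableSet_Ioi (a := (0:ℝ))))
  rw [volume_pi, Measure.restrict_pi_pi] at this
  unfold muP
  filter_upwards [this] with x hx k
  exact hx k trivial

lemma restrict_eq_pi (m : ℕ) : (volume : Measure (Fin m → ℝ)).restrict
    (Set.univ.pi fun _ => Set.Ioi (0 : ℝ)) = Measure.pi fun _ : Fin m => muP := by
  rw [volume_pi, Measure.restrict_pi_pi]; rfl

/-- The joint integrand. -/
noncomputable def FJ (n : ℕ) (τ : Fin (n + 2) → ℝ) (σ : Fin (n + 1) → ℝ)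
    (x : Fin (n + 2) → ℝ) (y : Fin (n + 1) → ℝ) : ℝ :=
  (√(x 0) * Real.exp (-(1 / 2 : ℝ) * ∑ k, τ k * x k)) *
    ∏ k : Fin (n + 1), ((1 / (Real.pi * √(x k.castSucc))) *
      (Real.exp (-σ k * y k) * (Real.sin (√(x k.castSucc) * y k) * Real.sin (√(x k.succ) * y k))))

/-- The left marginal integrand. -/
noncomputable def GLeft (n : ℕ) (τ : Fin (n + 2) → ℝ) (σ : Fin (n + 1) → ℝ)
    (x : Fin (n + 2) → ℝ) : ℝ :=
  (√(x 0) * Real.exp (-(1 / 2 : ℝ) * ∑ k, τ k * x k)) *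
    ∏ k : Fin (n + 1), transP (σ k) (x k.castSucc) (x k.succ)

/-- The one-dimensional factors in the `x` variables. -/
noncomputable def MF (n : ℕ) (τ : Fin (n + 2) → ℝ) (y : Fin (n + 1) → ℝ) : Fin (n + 2) → ℝ → ℝ :=
  Fin.cons (fun x => Real.exp (-(τ 0 / 2) * x) * Real.sin (√x * y 0))
    (Fin.snoc (fun i : Fin n => fun x => Real.exp (-(τ i.castSucc.succ / 2) * x)
        * Real.sin (√x * y i.castSucc) * Real.sin (√x * y i.succ) / √x)
      (fun x => Real.exp (-(τ (Fin.last (n + 1)) / 2) * x) * Real.sin (√x * y (Fin.last n)))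
        : Fin (n + 1) → ℝ → ℝ)

lemma MF_zero (n : ℕ) (τ : Fin (n + 2) → ℝ) (y : Fin (n + 1) → ℝ) : MF n τ y 0 =
    (fun x => Real.exp (-(τ 0 / 2) * x) * Real.sin (√x * y 0)) := by
  simp [MF]

lemma MF_mid (n : ℕ) (τ : Fin (n + 2) → ℝ) (y : Fin (n + 1) → ℝ) (i : Fin n) :
    MF n τ y i.castSucc.succ =
    (fun x => Real.exp (-(τ i.castSucc.succ / 2) * x)
        * Real.sin (√x * y i.castSucc) * Real.sin (√x * y i.succ) / √x) := by
  rw [MF, Fin.cons_succ, Fin.snoc_castSucc]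

lemma MF_last (n : ℕ) (τ : Fin (n + 2) → ℝ) (y : Fin (n + 1) → ℝ) :
    MF n τ y (Fin.last n).succ =
    (fun x => Real.exp (-(τ (Fin.last (n + 1)) / 2) * x) * Real.sin (√x * y (Fin.last n))) := by
  rw [MF, Fin.cons_succ, Fin.snoc_last]

lemma prod_split (n : ℕ) (f : Fin (n + 2) → ℝ) :
    ∏ j, f j = f 0 * ((∏ i : Fin n, f i.castSucc.succ) * f (Fin.last n).succ) := by
  rw [Fin.prod_univ_succ, Fin.prod_univ_castSucc]

lemma FJ_eq (n : ℕ) (τ : Fin (n + 2) → ℝ) (σ : Fin (n + 1) → ℝ)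
    (x : Fin (n + 2) → ℝ) (hx : ∀ k, 0 < x k) (y : Fin (n + 1) → ℝ) :
    FJ n τ σ x y = ((1 / Real.pi) ^ (n + 1) * ∏ k, Real.exp (-σ k * y k)) *
      ∏ j, MF n τ y j (x j) := by
  rw [prod_split, MF_zero, MF_last]
  simp only [MF_mid]
  have hE : Real.exp (-(1 / 2 : ℝ) * ∑ k, τ k * x k) = ∏ k, Real.exp (-(τ k / 2) * x k) := by
    rw [← Real.exp_sum, Finset.mul_sum]
    congr 1
    exact Finset.sum_congr rfl fun k _ => by ring
  rw [FJ, hE, prod_split]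
  have h0 : √(x 0) ≠ 0 := by have := hx 0; positivity
  have e1 : ∏ k : Fin (n + 1), (1 / (Real.pi * √(x k.castSucc)))
      = (1 / Real.pi) ^ (n + 1) * ((1 / √(x 0)) * ∏ i : Fin n, (1 / √(x i.castSucc.succ))) := by
    simp only [div_eq_mul_inv, one_mul, mul_inv]
    rw [Finset.prod_mul_distrib, Finset.prod_const, Finset.card_univ, Fintype.card_fin,
      Fin.prod_univ_succ (fun k : Fin (n + 1) => (√(x k.castSucc))⁻¹)]
    rfl
  have e2 : ∏ k : Fin (n + 1), Real.sin (√(x k.castSucc) * y k)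
      = Real.sin (√(x 0) * y 0) * ∏ i : Fin n, Real.sin (√(x i.castSucc.succ) * y i.succ) := by
    rw [Fin.prod_univ_succ]; rfl
  have e3 : ∏ k : Fin (n + 1), Real.sin (√(x k.succ) * y k)
      = (∏ i : Fin n, Real.sin (√(x i.castSucc.succ) * y i.castSucc))
        * Real.sin (√(x (Fin.last n).succ) * y (Fin.last n)) := by
    rw [Fin.prod_univ_castSucc]
  have e4 : ∏ i : Fin n, (Real.exp (-(τ i.castSucc.succ / 2) * x i.castSucc.succ)
        * Real.sin (√(x i.castSucc.succ) * y i.castSucc)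
        * Real.sin (√(x i.castSucc.succ) * y i.succ) / √(x i.castSucc.succ))
      = (∏ i : Fin n, Real.exp (-(τ i.castSucc.succ / 2) * x i.castSucc.succ))
        * (∏ i : Fin n, Real.sin (√(x i.castSucc.succ) * y i.castSucc))
        * (∏ i : Fin n, Real.sin (√(x i.castSucc.succ) * y i.succ))
        * ∏ i : Fin n, (1 / √(x i.castSucc.succ)) := by
    simp only [← Finset.prod_mul_distrib]
    exact Finset.prod_congr rfl fun i _ => by ring
  rw [Finset.prod_mul_distrib, Finset.prod_mul_distrib, Finset.prod_mul_distrib, e1, e2, e3, e4]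
  rw [← Fin.succ_last]
  field_simp

lemma FJ_int_y (n : ℕ) (τ : Fin (n + 2) → ℝ) (σ : Fin (n + 1) → ℝ) (hσ : ∀ k, 0 < σ k)
    (x : Fin (n + 2) → ℝ) (hx : ∀ k, 0 < x k) :
    ∫ y, FJ n τ σ x y ∂(Measure.pi fun _ => muP) = GLeft n τ σ x := by
  simp only [FJ, GLeft]
  rw [integral_const_mul, integral_fintype_prod_eq_prod (fun (k : Fin (n + 1)) (z : ℝ) =>
    ((1 / (Real.pi * √(x k.castSucc))) *
      (Real.exp (-σ k * z) * (Real.sin (√(x k.castSucc) * z) * Real.sin (√(x k.succ) * z)))))]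
  congr 1
  refine Finset.prod_congr rfl fun k _ => ?_
  rw [transP_eq (hσ k) (hx _) (hx _)]; rfl

lemma FJ_int_x (n : ℕ) (τ : Fin (n + 2) → ℝ) (hτ : ∀ k, 0 < τ k) (σ : Fin (n + 1) → ℝ)
    (y : Fin (n + 1) → ℝ) (hy : ∀ k, 0 < y k) :
    ∫ x, FJ n τ σ x y ∂(Measure.pi fun _ => muP) = (4 * Real.pi) *
      ((∏ k, Real.exp (-σ k * y k)) * (ellF (τ 0) (y 0) * ellF (τ (Fin.last (n + 1))) (y (Fin.last n))
        * ∏ i : Fin n, gF (τ i.castSucc.succ) (y i.castSucc) (y i.succ))) := by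
  have : ∫ x, FJ n τ σ x y ∂(Measure.pi fun _ => muP) =
      ∫ x, ((1 / Real.pi) ^ (n + 1) * ∏ k, Real.exp (-σ k * y k)) *
      ∏ j, MF n τ y j (x j) ∂(Measure.pi fun _ => muP) := by
    refine integral_congr_ae ?_
    filter_upwards [ae_pos_pi (n + 2)] with x hx
    exact FJ_eq n τ σ x hx y
  rw [this, integral_const_mul, integral_fintype_prod_eq_prod, prod_split, MF_zero, MF_last]
  simp only [MF_mid, muP]
  rw [end_int (hτ _) (hy _), end_int (hτ _) (hy _)]
  have : ∀ i : Fin n, ∫ x in Set.Ioi (0:ℝ), Real.exp (-(τ i.castSucc.succ / 2) * x)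
        * Real.sin (√x * y i.castSucc) * Real.sin (√x * y i.succ) / √x
      = Real.pi * gF (τ i.castSucc.succ) (y i.castSucc) (y i.succ) := fun i =>
    mid_int (hτ _) (hy _) (hy _)
  simp only [this]
  rw [Finset.prod_mul_distrib, Finset.prod_const, Finset.card_univ, Fintype.card_fin, one_div,
    inv_pow, pow_succ]
  field_simp
  try ring

/-- Dominating one-dimensional function. -/
noncomputable def BF (a x : ℝ) : ℝ := Real.exp (-(a / 2) * x) * (1 + 1 / √x)

lemma BF_integrable {a : ℝ} (ha : 0 < a) : Integrable (BF a) muP := by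
  have h1 := exp_neg_integrableOn_Ioi 0 (b := a / 2) (by positivity)
  have h2 := integrableOn_rpow_mul_exp_neg_mul_rpow (p := 1) (s := -(1/2)) (b := a / 2)
    (by norm_num) (by norm_num) (by positivity)
  refine (h1.add h2).congr ?_
  filter_upwards [ae_restrict_mem measurableSet_Ioi] with x hx
  have hx' : 0 < x := hx
  simp only [Pi.add_apply, BF, Real.rpow_one]
  rw [Real.rpow_neg hx'.le, ← Real.sqrt_eq_rpow]
  ring

lemma MF_bound (n : ℕ) (τ : Fin (n + 2) → ℝ) (y : Fin (n + 1) → ℝ) (j : Fin (n + 2)) (x : ℝ) :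
    |MF n τ y j x| ≤ BF (τ j) x := by
  have hs : ∀ z, |Real.sin z| ≤ 1 := Real.abs_sin_le_one
  have h0 : 0 ≤ 1 / √x := by positivity
  have he : ∀ (a z : ℝ), |Real.exp (-(a / 2) * x) * Real.sin z| ≤ BF a x := by
    intro a z
    rw [abs_mul, abs_of_pos (Real.exp_pos _), BF]
    gcongr
    linarith [hs z]
  refine Fin.cases ?_ (fun k => Fin.lastCases ?_ (fun i => ?_) k) j
  · rw [MF_zero]; exact he _ _
  · rw [MF_last]; exact he _ _
  · rw [MF_mid, BF]
    beta_reduce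
    rw [mul_assoc, mul_div_assoc, abs_mul, abs_of_pos (Real.exp_pos _)]
    gcongr
    rw [abs_div, abs_mul, abs_of_nonneg (Real.sqrt_nonneg x)]
    have : |Real.sin (√x * y i.castSucc)| * |Real.sin (√x * y i.succ)| ≤ 1 :=
      mul_le_one₀ (hs _) (abs_nonneg _) (hs _)
    calc _ ≤ 1 / √x := by gcongr
      _ ≤ _ := by linarith

lemma FJ_integrable (n : ℕ) (τ : Fin (n + 2) → ℝ) (hτ : ∀ k, 0 < τ k) (σ : Fin (n + 1) → ℝ)
    (hσ : ∀ k, 0 < σ k) :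
    Integrable (Function.uncurry (FJ n τ σ))
      ((Measure.pi fun _ => muP).prod (Measure.pi fun _ => muP)) := by
  have h1 : Integrable (fun x : Fin (n + 2) → ℝ => ∏ j, BF (τ j) (x j))
      (Measure.pi fun _ => muP) :=
    Integrable.fintype_prod (f := fun j => BF (τ j)) fun j => BF_integrable (hτ j)
  have h2 : Integrable (fun y : Fin (n + 1) → ℝ => ∏ k, Real.exp (-σ k * y k))
      (Measure.pi fun _ => muP) :=
    Integrable.fintype_prod (f := fun k z => Real.exp (-σ k * z))
      fun k => exp_neg_integrableOn_Ioi 0 (hσ k)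
  have h3 := (h1.mul_prod h2).const_mul ((1 / Real.pi) ^ (n + 1))
  refine Integrable.mono' h3 ?_ ?_
  · refine Measurable.aestronglyMeasurable ?_
    unfold Function.uncurry FJ
    fun_prop
  · have hx := (Measure.quasiMeasurePreserving_fst (μ := Measure.pi fun _ : Fin (n + 2) => muP)
      (ν := Measure.pi fun _ : Fin (n + 1) => muP)).ae (ae_pos_pi (n + 2))
    filter_upwards [hx] with z hz
    rw [Function.uncurry, FJ_eq n τ σ z.1 hz, norm_mul, norm_mul,
      Real.norm_of_nonneg (by positivity : 0 ≤ (1 / Real.pi) ^ (n + 1)),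
      Real.norm_of_nonneg (Finset.prod_nonneg fun k _ => (Real.exp_pos _).le)]
    rw [mul_assoc, mul_comm (∏ k, Real.exp (-σ k * z.2 k))]
    have hk : ‖∏ j, MF n τ z.2 j (z.1 j)‖ ≤ ∏ j, BF (τ j) (z.1 j) := by
      rw [norm_prod]
      exact Finset.prod_le_prod (fun j _ => norm_nonneg _) fun j _ => MF_bound n τ z.2 j _
    have : 0 ≤ ∏ k, Real.exp (-σ k * z.2 k) := Finset.prod_nonneg fun k _ => (Real.exp_pos _).le
    gcongr

lemma GLeft_integrable (n : ℕ) (τ : Fin (n + 2) → ℝ) (hτ : ∀ k, 0 < τ k) (σ : Fin (n + 1) → ℝ)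
    (hσ : ∀ k, 0 < σ k) : Integrable (GLeft n τ σ) (Measure.pi fun _ => muP) := by
  refine (FJ_integrable n τ hτ σ hσ).integral_prod_left.congr ?_
  filter_upwards [ae_pos_pi (n + 2)] with x hx
  exact FJ_int_y n τ σ hσ x hx

lemma GLeft_integral (n : ℕ) (τ : Fin (n + 2) → ℝ) (hτ : ∀ k, 0 < τ k) (σ : Fin (n + 1) → ℝ)
    (hσ : ∀ k, 0 < σ k) : ∫ x, GLeft n τ σ x ∂(Measure.pi fun _ => muP) =
      ∫ y, (4 * Real.pi) *
      ((∏ k, Real.exp (-σ k * y k)) * (ellF (τ 0) (y 0) * ellF (τ (Fin.last (n + 1))) (y (Fin.last n))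
        * ∏ i : Fin n, gF (τ i.castSucc.succ) (y i.castSucc) (y i.succ)))
        ∂(Measure.pi fun _ => muP) := by
  have e1 : ∫ x, GLeft n τ σ x ∂(Measure.pi fun _ => muP) =
      ∫ x, ∫ y, FJ n τ σ x y ∂(Measure.pi fun _ => muP) ∂(Measure.pi fun _ => muP) := by
    refine integral_congr_ae ?_
    filter_upwards [ae_pos_pi (n + 2)] with x hx
    exact (FJ_int_y n τ σ hσ x hx).symm
  rw [e1, integral_integral_swap (FJ_integrable n τ hτ σ hσ)]
  refine integral_congr_ae ?_
  filter_upwards [ae_pos_pi (n + 1)] with y hy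
  exact FJ_int_x n τ hτ σ y hy

/-- Integrating out the last variable. -/
lemma last_out (m : ℕ) (G : (Fin (m + 1) → ℝ) → ℝ) (hGm : Integrable G (Measure.pi fun _ => muP))
    (hG0 : ∀ x, (∀ k, 0 < x k) → 0 ≤ G x) (c : ℝ) (hc : 0 < c) :
    ∫ x : Fin (m + 2) → ℝ, G (fun i => x i.castSucc) *
        transP c (x (Fin.last m).castSucc) (x (Fin.last (m + 1))) ∂(Measure.pi fun _ => muP)
      = ∫ x, G x ∂(Measure.pi fun _ => muP) := by
  have hmp := measurePreserving_piFinSuccAbove (fun _ : Fin (m + 2) => muP) (Fin.last (m + 1))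
  have e : ∀ x : Fin (m + 2) → ℝ, G (fun i => x i.castSucc) *
        transP c (x (Fin.last m).castSucc) (x (Fin.last (m + 1))) =
      (fun z : ℝ × (Fin (m + 1) → ℝ) => G z.2 * transP c (z.2 (Fin.last m)) z.1)
        (MeasurableEquiv.piFinSuccAbove (fun _ => ℝ) (Fin.last (m + 1)) x) := by
    intro x
    simp [MeasurableEquiv.piFinSuccAbove, Fin.init_def]
  simp only [e]
  rw [hmp.integral_comp (MeasurableEquiv.measurableEmbedding _)
    (fun z : ℝ × (Fin (m + 1) → ℝ) => G z.2 * transP c (z.2 (Fin.last m)) z.1)]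
  have hint : Integrable (fun z : ℝ × (Fin (m + 1) → ℝ) => G z.2 * transP c (z.2 (Fin.last m)) z.1)
      (muP.prod (Measure.pi fun _ => muP)) := by
    rw [integrable_prod_iff']
    · constructor
      · filter_upwards [ae_pos_pi (m + 1)] with x hx
        exact (transP_int_aux hc (hx _)).1.const_mul _
      · refine hGm.congr ?_
        filter_upwards [ae_pos_pi (m + 1)] with x hx
        have : ∫ y, ‖G x * transP c (x (Fin.last m)) y‖ ∂muP
            = ∫ y, G x * transP c (x (Fin.last m)) y ∂muP := by
          refine setIntegral_congr_fun measurableSet_Ioi fun y hy => ?_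
          exact Real.norm_of_nonneg (mul_nonneg (hG0 x hx) (transP_nonneg hc (hx _) hy))
        rw [this, integral_const_mul]
        unfold muP
        rw [(transP_int_aux hc (hx _)).2, mul_one]
    · refine AEStronglyMeasurable.mul hGm.1.comp_snd ?_
      refine Measurable.aestronglyMeasurable ?_
      unfold transP
      fun_prop
  refine (integral_prod_symm _ hint).trans ?_
  refine integral_congr_ae ?_
  filter_upwards [ae_pos_pi (m + 1)] with x hx
  rw [integral_const_mul]
  unfold muP
  rw [(transP_int_aux hc (hx _)).2, mul_one]
/-- **Dual representation of the Brownian excursion, boundary case `t_d = 1`.**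
Here `d = n + 2 ≥ 2`, `s : Fin (n+3) → ℝ` lists `s₀ < … < s_d` with `s₀ = 0`, and
`t : Fin (n+4) → ℝ` lists `t₀, t₁, …, t_d, t_{d+1}` with `t₀ = 0`,
`t₀ < t₁ < … < t_{d-1} < t_d` and `t_d = 1 = t_{d+1}`. -/
theorem excursion_dual_boundary_right (n : ℕ) (s : Fin (n + 3) → ℝ) (t : Fin (n + 4) → ℝ)
    (hs0 : s 0 = 0) (hs : StrictMono s)
    (ht0 : t 0 = 0)
    (htmono : StrictMonoOn t (Set.Iic (⟨n + 2, by omega⟩ : Fin (n + 4))))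
    (htd : t ⟨n + 2, by omega⟩ = 1) (htlast : t (Fin.last (n + 3)) = 1) :
    ((1 / Real.sqrt (2 * Real.pi)) *
        ∫ x : Fin (n + 3) → ℝ in Set.univ.pi fun _ => Set.Ioi (0 : ℝ),
          Real.sqrt (x 0) *
            Real.exp (-(1 / 2 : ℝ) * ∑ k : Fin (n + 3), (t k.succ - t k.castSucc) * x k) *
            ∏ k : Fin (n + 2), transP (s k.succ - s k.castSucc) (x k.castSucc) (x k.succ)) =
      ∫ y : Fin (n + 1) → ℝ in Set.univ.pi fun _ => Set.Ioi (0 : ℝ),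
        Real.exp (-(∑ k : Fin (n + 1), (s k.succ.castSucc - s k.castSucc.castSucc) * y k)) *
          excDensity n (fun i => t i.succ.castSucc.castSucc) y := by
  have hτ : ∀ k : Fin (n + 2), 0 < t k.castSucc.succ - t k.castSucc.castSucc := by
    intro k
    have := htmono (a := k.castSucc.castSucc) (b := k.castSucc.succ)
      (by rw [Set.mem_Iic, Fin.le_def]; simp; try omega)
      (by rw [Set.mem_Iic, Fin.le_def]; simp; try omega) (by rw [Fin.lt_def]; simp)
    linarith
  have hσ : ∀ k : Fin (n + 2), 0 < s k.succ - s k.castSucc := fun k => by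
    have := hs (Fin.castSucc_lt_succ (i := k))
    linarith
  set τ : Fin (n + 2) → ℝ := fun k => t k.castSucc.succ - t k.castSucc.castSucc with hτd
  set σ : Fin (n + 1) → ℝ := fun k => s k.castSucc.succ - s k.castSucc.castSucc with hσd
  have hσ' : ∀ k, 0 < σ k := fun k => hσ _
  rw [restrict_eq_pi, restrict_eq_pi]
  have key := last_out (n + 1) (GLeft n τ σ) (GLeft_integrable n τ hτ σ hσ') (fun x hx => by
    unfold GLeft
    refine mul_nonneg (by positivity) (Finset.prod_nonneg fun k _ => ?_)
    exact transP_nonneg (hσ' k) (hx _) (hx _)) _ (hσ (Fin.last (n + 1)))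
  have hl : t (Fin.last (n + 2)).succ - t (Fin.last (n + 2)).castSucc = 0 := by
    have h1 : t (Fin.last (n + 2)).succ = 1 := htlast
    have h2 : t (Fin.last (n + 2)).castSucc = 1 := htd
    rw [h1, h2, sub_self]
  have e1 : ∀ x : Fin (n + 3) → ℝ, √(x 0) *
            Real.exp (-(1 / 2 : ℝ) * ∑ k : Fin (n + 3), (t k.succ - t k.castSucc) * x k) *
            ∏ k : Fin (n + 2), transP (s k.succ - s k.castSucc) (x k.castSucc) (x k.succ)
      = GLeft n τ σ (fun i => x i.castSucc) *
        transP (s (Fin.last (n + 1)).succ - s (Fin.last (n + 1)).castSucc)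
          (x (Fin.last (n + 1)).castSucc) (x (Fin.last (n + 2))) := by
    intro x
    rw [Fin.sum_univ_castSucc, hl, zero_mul, add_zero, Fin.prod_univ_castSucc, ← mul_assoc]
    rfl
  simp only [e1]
  rw [key, GLeft_integral n τ hτ σ hσ', ← integral_const_mul]
  congr 1
  ext y
  have hc : 1 / √(2 * Real.pi) * (4 * Real.pi) = √(8 * Real.pi) := by
    rw [one_div_mul_eq_div, div_eq_iff (by positivity), ← Real.sqrt_mul (by positivity),
      show 8 * Real.pi * (2 * Real.pi) = (4 * Real.pi) ^ 2 by ring, Real.sqrt_sq (by positivity)]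
  have hE : Real.exp (-(∑ k : Fin (n + 1), (s k.succ.castSucc - s k.castSucc.castSucc) * y k))
      = ∏ k, Real.exp (-σ k * y k) := by
    rw [← Real.exp_sum, ← Finset.sum_neg_distrib]
    congr 1
    exact Finset.sum_congr rfl fun k _ => (neg_mul _ _).symm
  have h0 : τ 0 = t (0 : Fin (n + 1)).succ.castSucc.castSucc := by
    have : τ 0 = t (0 : Fin (n + 1)).succ.castSucc.castSucc - t 0 := rfl
    rw [this, ht0, sub_zero]
  have h1 : τ (Fin.last (n + 1)) = 1 - t (Fin.last n).succ.castSucc.castSucc := by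
    rw [← htd]; rfl
  rw [hE, ← mul_assoc, hc, excDensity, h0, h1]
  have h2 : ∏ k : Fin n, gF (t k.succ.succ.castSucc.castSucc - t k.castSucc.succ.castSucc.castSucc)
      (y k.castSucc) (y k.succ) = ∏ i : Fin n, gF (τ i.castSucc.succ) (y i.castSucc) (y i.succ) := rfl
  rw [h2]
  ring
end
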